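/- There is no Hurwitz tree T of type (G, 2), where G = Q_{2^{n+1}} is the generalized quaternion group (n ≥ 2), with δ_T = 0 and Artin character a_T satisfying ⟨a_T, χ₀⟩ = 2 and ⟨a_T, χ₁⟩ = ⟨a_T, χ₂⟩ ≥ 2. -/

import Mathlib

open Finset

/-- A rooted metric tree: a finite set of vertices with a parent function, a root, a
unique trunk edge at the root, and a nonnegative rational thickness attached to each
edge (recorded at its target vertex), which vanishes exactly at the leaves. -/
structure MetricRootedTree where
  V : Type
  [fin : Fintype V]
  [deq : DecidableEq V]
  root : V
  parent : V → V
  parent_root : parent root = root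
  reaches_root : ∀ v, ∃ n : ℕ, parent^[n] v = root
  trunk : V
  trunk_ne : trunk ≠ root
  trunk_parent : parent trunk = root
  trunk_unique : ∀ w, w ≠ root → parent w = root → w = trunk
  eps : V → ℚ
  eps_nonneg : ∀ v, 0 ≤ eps v
  eps_zero_iff : ∀ v, v ≠ root → (eps v = 0 ↔ ∀ w, parent w = v → w = v)

attribute [instance] MetricRootedTree.fin MetricRootedTree.deq

namespace MetricRootedTree

variable (T : MetricRootedTree)

/-- `v ≤ w` : there is an oriented path from `v` down to `w`. -/
def le (v w : T.V) : Prop := ∃ n : ℕ, T.parent^[n] w = v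

/-- A leaf is a maximal vertex (no children) other than the root. -/
def IsLeaf (v : T.V) : Prop := v ≠ T.root ∧ ∀ w, T.parent w = v → w = v

open Classical in
/-- The set `B` of leaves. -/
noncomputable def leaves : Finset T.V := Finset.univ.filter T.IsLeaf

open Classical in
/-- Inverse distance between two leaves: the sum of the thicknesses of the edges on the
common initial segment of the paths from the root to `b₁` and to `b₂`. -/
noncomputable def idist (b₁ b₂ : T.V) : ℚ :=
  ∑ v ∈ Finset.univ.filter (fun v => T.le v b₁ ∧ T.le v b₂ ∧ v ≠ T.root), T.eps v

/-- The density of a set of leaves `A` at `b ∈ A`: `d(A,b) = Σ_{b' ∈ A, b' ≠ b} d(b,b')`. -/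
noncomputable def density (A : Finset T.V) (b : T.V) : ℚ :=
  ∑ b' ∈ A.erase b, T.idist b b'

open Classical in
/-- `n(A,v) = |{b' ∈ A : b' ≠ b, v ≤ b'}|`. -/
noncomputable def nCount (A : Finset T.V) (b v : T.V) : ℕ :=
  ((A.erase b).filter (fun b' => T.le v b')).card

end MetricRootedTree

section Characters

open Classical

variable {G : Type} [Group G] [Fintype G]

/-- Inner product of class functions on a finite group. -/
noncomputable def innerCF (χ₁ χ₂ : G → ℂ) : ℂ :=
  (Fintype.card G : ℂ)⁻¹ * ∑ g : G, (starRingEnd ℂ) (χ₁ g) * χ₂ g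

/-- Induction of a class function supported on a subgroup `H ≤ G` to `G`. -/
noncomputable def indCF (H : Subgroup G) (f : G → ℂ) : G → ℂ :=
  fun g => (Nat.card H : ℂ)⁻¹ * ∑ x : G, f (x⁻¹ * g * x)

open Classical in
/-- The augmentation character `u_H = r_H - 1_H` of `H`, extended by zero to `G`. -/
noncomputable def augChar (H : Subgroup G) : G → ℂ :=
  fun h => if h ∈ H then (if h = 1 then (Nat.card H : ℂ) - 1 else -1) else 0

/-- The induced augmentation character `(u_H)^* = Ind_H^G (r_H - 1_H)`. -/
noncomputable def indAug (H : Subgroup G) : G → ℂ := indCF H (augChar H)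

open Classical in
/-- The class function `δ_H^mult` of a cyclic `p`-subgroup `H ≤ G` of order `p^m`
(extended by zero to `G`): `δ(σ^a) = -p^(i+1)/(p-1)` for `σ^a ≠ 1` with `i = ord_p a`
(so that `σ^a` has order `p^(m-i)`), and `δ(1) = m·p^m`. -/
noncomputable def deltaMultSub (p : ℕ) (H : Subgroup G) : G → ℂ :=
  fun h =>
    if h ∈ H then
      (if h = 1 then ((Nat.card H).factorization p : ℂ) * (Nat.card H : ℂ)
       else -((p : ℂ) ^ ((Nat.card H).factorization p - (orderOf h).factorization p + 1))
              / ((p : ℂ) - 1))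
    else 0

end Characters

open Classical in
/-- The set of children (successors) of a vertex. -/
noncomputable def MetricRootedTree.children (T : MetricRootedTree) (v : T.V) : Finset T.V :=
  Finset.univ.filter (fun w => T.parent w = v ∧ w ≠ v)

/-- A Hurwitz tree of type `(G,p)`: a rooted metric tree with monodromy groups `G_v`,
Artin characters `a_e` (attached to the target vertex of each edge) and depth characters
`δ_v`, subject to axioms (H1)–(H5) of Brewis–Wewers. -/
structure HurwitzTree (G : Type) [Group G] [Fintype G] (p : ℕ) extends MetricRootedTree where
  Gv : V → Subgroup G
  av : V → G → ℂ
  dv : V → G → ℂ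
  -- (H1): monodromy groups decrease (up to conjugacy) along edges …
  h1_sub : ∀ v w, parent w = v → w ≠ v → ∃ g : G, ∀ x ∈ Gv w, g * x * g⁻¹ ∈ Gv v
  -- … with branching `Σ_{v → v'} [G_v : G_{v'}] > 1` at interior non-root vertices …
  h1_branch : ∀ v, v ≠ root → ¬ toMetricRootedTree.IsLeaf v →
    1 < ∑ w ∈ toMetricRootedTree.children v, Nat.card (Gv v) / Nat.card (Gv w)
  -- … and monodromy group `G` at the root and at the target of the trunk.
  h1_root : Gv root = ⊤
  h1_trunk : Gv trunk = ⊤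
  -- (H2): the monodromy group at each leaf is nontrivial and cyclic.
  h2 : ∀ b, toMetricRootedTree.IsLeaf b → Gv b ≠ ⊥ ∧ IsCyclic (Gv b)
  -- (H3): the Artin characters.
  h3_leaf : ∀ b, toMetricRootedTree.IsLeaf b → av b = indAug (Gv b)
  h3_inner : ∀ v, v ≠ root → ¬ toMetricRootedTree.IsLeaf v →
    av v = fun g => ∑ w ∈ toMetricRootedTree.children v, av w g
  -- (H4): the depth characters, `δ_{t(e)} = δ_{s(e)} + ε_e·(a_e - (u_{G_{t(e)}})^*)`.
  h4 : ∀ v, v ≠ root →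
    dv v = fun g => dv (parent v) g + (eps v : ℂ) * (av v g - indAug (Gv v) g)
  -- (H5): at each leaf, `δ_b` is induced from `δ^mult` of the Sylow `p`-subgroup of `G_b`.
  h5 : ∀ b, toMetricRootedTree.IsLeaf b → ∀ P : Subgroup G, P ≤ Gv b → IsPGroup p P →
    (∀ Q : Subgroup G, Q ≤ Gv b → IsPGroup p Q → Q ≤ P) →
    dv b = indCF P (deltaMultSub p P)

namespace HurwitzTree

variable {G : Type} [Group G] [Fintype G] {p : ℕ} (T : HurwitzTree G p)

/-- The depth `δ_T` of a Hurwitz tree. -/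
noncomputable def depth : G → ℂ := T.dv T.root

/-- The Artin character `a_T` of a Hurwitz tree (the Artin character of the trunk). -/
noncomputable def artin : G → ℂ := T.av T.trunk

end HurwitzTree

open Subgroup

namespace MetricRootedTree

variable (T : MetricRootedTree)

lemma iter_root (k : ℕ) : T.parent^[k] T.root = T.root :=
  Function.iterate_fixed T.parent_root k

lemma le_refl' (v : T.V) : T.le v v := ⟨0, rfl⟩

lemma le_trans' {u v w : T.V} (h : T.le u v) (h' : T.le v w) : T.le u w := by
  obtain ⟨n, rfl⟩ := h
  obtain ⟨m, rfl⟩ := h'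
  exact ⟨n + m, by rw [Function.iterate_add_apply]⟩

lemma le_parent (v : T.V) : T.le (T.parent v) v := ⟨1, rfl⟩

lemma le_cases {u v : T.V} (h : T.le u v) : u = v ∨ T.le u (T.parent v) := by
  obtain ⟨n, rfl⟩ := h
  cases n with
  | zero => left; rfl
  | succ k => right; exact ⟨k, by rw [Function.iterate_succ_apply]⟩

lemma eq_root_of_periodic {v : T.V} {k : ℕ} (hk : 0 < k) (h : T.parent^[k] v = v) :
    v = T.root := by
  obtain ⟨n, hn⟩ := T.reaches_root v
  have h1 : T.parent^[k * n] v = v := by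
    rw [Function.iterate_mul]; exact Function.iterate_fixed h n
  obtain ⟨c, hc⟩ : ∃ c, k * n = c + n := ⟨k * n - n, by
    have : n ≤ k * n := Nat.le_mul_of_pos_left n hk
    omega⟩
  rw [hc, Function.iterate_add_apply, hn, T.iter_root] at h1
  exact h1.symm

lemma le_antisymm' {v w : T.V} (h : T.le v w) (h' : T.le w v) : v = w := by
  obtain ⟨n, hn⟩ := h
  obtain ⟨m, hm⟩ := h'
  have h1 : T.parent^[n + m] v = v := by rw [Function.iterate_add_apply, hm, hn]
  rcases Nat.eq_zero_or_pos (n + m) with h0 | h0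
  · have : n = 0 := by omega
    subst this; exact hn.symm
  · have hv := T.eq_root_of_periodic h0 h1
    rw [hv, T.iter_root] at hm
    rw [hv, hm]

lemma parent_ne {v : T.V} (hv : v ≠ T.root) : T.parent v ≠ v := fun h =>
  hv (T.eq_root_of_periodic (k := 1) one_pos h)

lemma le_total_of {u v w : T.V} (h : T.le u w) (h' : T.le v w) : T.le u v ∨ T.le v u := by
  obtain ⟨n, rfl⟩ := h
  obtain ⟨m, rfl⟩ := h'
  rcases Nat.le_total n m with h | h
  · right; exact ⟨m - n, by rw [← Function.iterate_add_apply, Nat.sub_add_cancel h]⟩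
  · left; exact ⟨n - m, by rw [← Function.iterate_add_apply, Nat.sub_add_cancel h]⟩

lemma trunk_le {v : T.V} (hv : v ≠ T.root) : T.le T.trunk v := by
  obtain ⟨n, hn⟩ := T.reaches_root v
  induction n generalizing v with
  | zero => exact absurd hn hv
  | succ k ih =>
    rw [Function.iterate_succ_apply] at hn
    by_cases h : T.parent v = T.root
    · rw [T.trunk_unique v hv h]; exact T.le_refl' _
    · exact T.le_trans' (ih h hn) (T.le_parent v)

lemma path_sum (d e : T.V → ℂ) (h0 : d T.root = 0)
    (h : ∀ v, v ≠ T.root → d v = d (T.parent v) + e v) [∀ v, DecidablePred fun u => T.le u v ∧ u ≠ T.root] (v : T.V) :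
    d v = ∑ u ∈ Finset.univ.filter (fun u => T.le u v ∧ u ≠ T.root), e u := by
  obtain ⟨n, hn⟩ := T.reaches_root v
  induction n generalizing v with
  | zero =>
    have hn : v = T.root := hn
    subst hn
    rw [h0, Finset.filter_false_of_mem, Finset.sum_empty]
    rintro u - ⟨⟨k, hk⟩, hu⟩
    rw [T.iter_root] at hk
    exact hu hk.symm
  | succ k ih =>
    rw [Function.iterate_succ_apply] at hn
    by_cases hv : v = T.root
    · subst hv
      apply ih
      rw [T.parent_root] at hn
      exact hn
    · rw [h v hv, ih _ hn]
      have : Finset.univ.filter (fun u => T.le u v ∧ u ≠ T.root)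
          = insert v (Finset.univ.filter (fun u => T.le u (T.parent v) ∧ u ≠ T.root)) := by
        ext u
        simp only [Finset.mem_filter, Finset.mem_univ, true_and, Finset.mem_insert]
        constructor
        · rintro ⟨h1, h2⟩
          rcases T.le_cases h1 with h3 | h3
          · exact Or.inl h3
          · exact Or.inr ⟨h3, h2⟩
        · rintro (rfl | ⟨h1, h2⟩)
          · exact ⟨T.le_refl' _, hv⟩
          · exact ⟨T.le_trans' h1 (T.le_parent v), h2⟩
      rw [this, Finset.sum_insert, add_comm]
      simp only [Finset.mem_filter, Finset.mem_univ, true_and, not_and]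
      intro h1
      exact absurd (T.le_antisymm' (T.le_parent v) h1) (T.parent_ne hv)

open Classical in
lemma subtree_sum (c : T.V → ℂ)
    (h : ∀ v, v ≠ T.root → ¬ T.IsLeaf v → c v = ∑ w ∈ T.children v, c w)
    (v : T.V) (hv : v ≠ T.root) :
    c v = ∑ b ∈ T.leaves.filter (fun b => T.le v b), c b := by
  induction hN : (Finset.univ.filter (fun w => T.le v w)).card using Nat.strong_induction_on
    generalizing v with
  | _ N ih =>
  by_cases hl : T.IsLeaf v
  · have : T.leaves.filter (fun b => T.le v b) = {v} := by
      ext b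
      simp only [leaves, Finset.mem_filter, Finset.mem_univ, true_and, Finset.mem_singleton]
      constructor
      · rintro ⟨-, n, hn⟩
        induction n generalizing b with
        | zero => exact hn
        | succ k ih2 =>
          rw [Function.iterate_succ_apply] at hn
          have := ih2 _ hn
          exact hl.2 b this
      · rintro rfl; exact ⟨hl, T.le_refl' _⟩
    rw [this, Finset.sum_singleton]
  · rw [h v hv hl]
    have hch : ∀ w ∈ T.children v, T.parent w = v ∧ w ≠ v := by
      intro w hw
      simpa [children] using hw
    have h1 : ∀ w ∈ T.children v, c w = ∑ b ∈ T.leaves.filter (fun b => T.le w b), c b := by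
      intro w hw
      obtain ⟨hp, hne⟩ := hch w hw
      have hvw : T.le v w := hp ▸ T.le_parent w
      refine ih _ ?_ w ?_ rfl
      · rw [← hN]
        apply Finset.card_lt_card
        rw [Finset.ssubset_iff_of_subset]
        · refine ⟨v, by simp [T.le_refl'], ?_⟩
          simp only [Finset.mem_filter, Finset.mem_univ, true_and]
          intro hwv
          exact hne (T.le_antisymm' hwv hvw)
        · intro u hu
          simp only [Finset.mem_filter, Finset.mem_univ, true_and] at hu ⊢
          exact T.le_trans' hvw hu
      · rintro rfl
        rw [T.parent_root] at hp
        exact hv hp.symm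
    rw [Finset.sum_congr rfl h1, ← Finset.sum_biUnion]
    · apply Finset.sum_congr _ (fun _ _ => rfl)
      ext b
      simp only [Finset.mem_biUnion, Finset.mem_filter]
      constructor
      · rintro ⟨w, hw, hb, hwb⟩
        have hvw : T.le v w := (hch w hw).1 ▸ T.le_parent w
        exact ⟨hb, T.le_trans' hvw hwb⟩
      · rintro ⟨hb, n, hn⟩
        have hbl : T.IsLeaf b := by simpa [leaves] using hb
        suffices ∀ (u : T.V), u ≠ v → T.parent^[n] u = v →
            ∃ w ∈ T.children v, T.le w u by
          obtain ⟨w, hw, hwb⟩ := this b (by rintro rfl; exact hl hbl) hn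
          exact ⟨w, hw, hb, hwb⟩
        clear hn
        induction n with
        | zero => intro u hu hn; exact absurd hn hu
        | succ k ih2 =>
          intro u hu hn
          rw [Function.iterate_succ_apply] at hn
          by_cases hpu : T.parent u = v
          · exact ⟨u, by simp [children, hpu, hu], T.le_refl' _⟩
          · obtain ⟨w, hw, hwu⟩ := ih2 _ hpu hn
            exact ⟨w, hw, T.le_trans' hwu (T.le_parent u)⟩
    · intro w hw w' hw' hne
      rw [Function.onFun, Finset.disjoint_left]
      intro b hb hb'
      simp only [Finset.mem_filter] at hb hb'
      obtain ⟨hp, hwv⟩ := hch w hw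
      obtain ⟨hp', hwv'⟩ := hch w' hw'
      rcases T.le_total_of hb.2 hb'.2 with h2 | h2
      · rcases T.le_cases h2 with h3 | h3
        · exact hne h3
        · rw [hp'] at h3
          exact hwv (T.le_antisymm' h3 (hp ▸ T.le_parent w))
      · rcases T.le_cases h2 with h3 | h3
        · exact hne h3.symm
        · rw [hp] at h3
          exact hwv' (T.le_antisymm' h3 (hp' ▸ T.le_parent w'))

open Classical in
lemma depth_eq_density (c u d : T.V → ℂ) (Q : T.V → Prop)
    (hc : ∀ v, v ≠ T.root → ¬ T.IsLeaf v → c v = ∑ w ∈ T.children v, c w)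
    (hcl : ∀ b, T.IsLeaf b → c b = if Q b then 1 else 0)
    (hd0 : d T.root = 0)
    (hd : ∀ v, v ≠ T.root → d v = d (T.parent v) + (T.eps v : ℂ) * (c v - u v))
    (b : T.V) (hb : T.IsLeaf b) (hQ : Q b)
    (hu : ∀ v, T.le v b → u v = 1) :
    d b = (T.density (T.leaves.filter Q) b : ℂ) := by
  rw [T.path_sum d (fun v => (T.eps v : ℂ) * (c v - u v)) hd0 hd b]
  have hbm : b ∈ T.leaves.filter Q := by simp [leaves, hb, hQ]
  have h1 : ∀ v ∈ Finset.univ.filter (fun v => T.le v b ∧ v ≠ T.root),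
      (T.eps v : ℂ) * (c v - u v)
        = ∑ b' ∈ (T.leaves.filter Q).erase b, if T.le v b' then (T.eps v : ℂ) else 0 := by
    intro v hv
    simp only [Finset.mem_filter, Finset.mem_univ, true_and] at hv
    have h2 : c v = ∑ b' ∈ T.leaves.filter Q, if T.le v b' then (1 : ℂ) else 0 := by
      rw [T.subtree_sum c hc v hv.2, Finset.sum_filter, Finset.sum_filter]
      apply Finset.sum_congr rfl
      intro b' hb'
      have hbl : T.IsLeaf b' := by simpa [leaves] using hb'
      rw [hcl b' hbl]
      by_cases h3 : Q b' <;> by_cases h4 : T.le v b' <;> simp [h3, h4]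
    rw [hu v hv.1, h2, ← Finset.add_sum_erase _ _ hbm, if_pos hv.1, add_sub_cancel_left,
      Finset.mul_sum]
    apply Finset.sum_congr rfl
    intro b' _
    split_ifs <;> simp
  rw [Finset.sum_congr rfl h1, Finset.sum_comm, density]
  push_cast
  apply Finset.sum_congr rfl
  intro b' _
  rw [idist, ← Finset.sum_filter, Finset.filter_filter]
  push_cast
  apply Finset.sum_congr _ (fun _ _ => rfl)
  ext v
  simp only [Finset.mem_filter, Finset.mem_univ, true_and]
  tauto

lemma idist_nonneg (b b' : T.V) : 0 ≤ T.idist b b' :=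
  Finset.sum_nonneg fun v _ => T.eps_nonneg v

end MetricRootedTree

lemma HurwitzTree.mono {G : Type} [Group G] [Fintype G] {p : ℕ} (T : HurwitzTree G p)
    {v b : T.V} (h : T.le v b) : ∃ g : G, ∀ x ∈ T.Gv b, g * x * g⁻¹ ∈ T.Gv v := by
  obtain ⟨n, rfl⟩ := h
  induction n generalizing b with
  | zero => exact ⟨1, by simp⟩
  | succ k ih =>
    rw [Function.iterate_succ_apply]
    obtain ⟨g, hg⟩ := ih (b := T.parent b)
    by_cases hb : b = T.parent b
    · rw [← hb] at hg ⊢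
      exact ⟨g, hg⟩
    · obtain ⟨g', hg'⟩ := T.h1_sub _ b rfl hb
      refine ⟨g * g', fun x hx => ?_⟩
      have := hg _ (hg' x hx)
      simpa [mul_assoc] using this

section CF
variable {G : Type} [Group G] [Fintype G]

open Classical in
lemma innerCF_indCF (χ : G →* ℂˣ) (H : Subgroup G) (f : G → ℂ) :
    innerCF (fun g => (χ g : ℂ)) (indCF H f)
      = (Nat.card H : ℂ)⁻¹ * ∑ g : G, (starRingEnd ℂ) (χ g : ℂ) * f g := by
  unfold innerCF indCF
  have h1 : ∀ x : G, ∑ g : G, (starRingEnd ℂ) (χ g : ℂ) * f (x⁻¹ * g * x)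
      = ∑ g : G, (starRingEnd ℂ) (χ g : ℂ) * f g := by
    intro x
    refine Fintype.sum_equiv (MulAut.conj x⁻¹).toEquiv _ _ (fun g => ?_)
    have : χ ((MulAut.conj x⁻¹) g) = χ g := by
      simp [MulAut.conj_apply, mul_comm]
    simp only [MulEquiv.toEquiv_eq_coe, MulEquiv.coe_toEquiv, this]
    simp [MulAut.conj_apply]
  have h2 : ∑ g : G, (starRingEnd ℂ) (χ g : ℂ) *
      ((Nat.card H : ℂ)⁻¹ * ∑ x : G, f (x⁻¹ * g * x))
      = (Nat.card H : ℂ)⁻¹ * ((Fintype.card G : ℂ) *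
        ∑ g : G, (starRingEnd ℂ) (χ g : ℂ) * f g) := by
    calc _ = (Nat.card H : ℂ)⁻¹ * ∑ g : G, ∑ x : G,
          (starRingEnd ℂ) (χ g : ℂ) * f (x⁻¹ * g * x) := by
          rw [Finset.mul_sum]
          apply Finset.sum_congr rfl
          intro g _
          rw [← Finset.mul_sum]; ring
      _ = _ := by
          rw [Finset.sum_comm, Finset.sum_congr rfl (fun x _ => h1 x)]
          simp
  rw [h2]
  have : (Fintype.card G : ℂ) ≠ 0 := by exact_mod_cast Fintype.card_ne_zero
  field_simp

/-- `χ` takes the value `-1` on `H`. -/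
def NTr (χ : G →* ℂˣ) (H : Subgroup G) : Prop := ∃ g ∈ H, χ g = -1

open Classical in
lemma innerCF_indAug (χ : G →* ℂˣ) (hχ : ∀ g, χ g = 1 ∨ χ g = -1) (H : Subgroup G) :
    innerCF (fun g => (χ g : ℂ)) (indAug H) = if NTr χ H then 1 else 0 := by
  rw [indAug, innerCF_indCF]
  have hconj : ∀ g, (starRingEnd ℂ) (χ g : ℂ) = χ g := by
    intro g
    rcases hχ g with h | h <;> simp [h]
  have hcard : (Nat.card H : ℂ) ≠ 0 := by exact_mod_cast Nat.card_pos.ne'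
  have h1 : ∑ g : G, (starRingEnd ℂ) (χ g : ℂ) * augChar H g
      = (Nat.card H : ℂ) - ∑ g : H, (χ g : ℂ) := by
    have : ∀ g, (starRingEnd ℂ) (χ g : ℂ) * augChar H g
        = (if g = 1 then (Nat.card H : ℂ) else 0) - if g ∈ H then (χ g : ℂ) else 0 := by
      intro g
      rw [hconj, augChar]
      by_cases h1 : g = 1
      · subst h1; simp
      · by_cases h2 : g ∈ H <;> simp [h1, h2]
    rw [Finset.sum_congr rfl (fun g _ => this g), Finset.sum_sub_distrib]
    congr 1
    · simp
    · rw [← Finset.sum_filter]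
      exact Finset.sum_subtype _ (by simp) _
  rw [h1]
  have h2 := sum_hom_units ((Units.coeHom ℂ).comp (χ.comp H.subtype))
  have h3 : ∑ g : H, (χ g : ℂ) = ∑ g : H, ((Units.coeHom ℂ).comp (χ.comp H.subtype)) g := rfl
  rw [h3, h2]
  split_ifs with h4 h5 h5
  · obtain ⟨g, hg, hg'⟩ := h5
    have := DFunLike.congr_fun h4 ⟨g, hg⟩
    simp [hg'] at this
    norm_num at this
  · simp
  · simp [hcard]
  · exfalso
    apply h4
    ext ⟨g, hg⟩
    unfold NTr at h5
    push Not at h5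
    have := (hχ g).resolve_right (h5 g hg)
    simp [this]

lemma innerCF_sum {ι : Type*} (χ : G → ℂ) (s : Finset ι) (f : ι → G → ℂ) :
    innerCF χ (fun g => ∑ i ∈ s, f i g) = ∑ i ∈ s, innerCF χ (f i) := by
  unfold innerCF
  rw [← Finset.mul_sum, Finset.sum_comm]
  simp only [Finset.mul_sum]

lemma innerCF_h4 (χ : G → ℂ) (d a u : G → ℂ) (e : ℂ) :
    innerCF χ (fun g => d g + e * (a g - u g))
      = innerCF χ d + e * (innerCF χ a - innerCF χ u) := by
  unfold innerCF
  simp only [mul_add, mul_sub, Finset.sum_add_distrib, Finset.sum_sub_distrib, Finset.mul_sum]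
  congr 1
  congr 1 <;> exact Finset.sum_congr rfl (fun _ _ => by ring)

lemma indCF_central (H : Subgroup G) (f : G → ℂ) (z : G) (hz : ∀ x, x⁻¹ * z * x = z) :
    indCF H f z = (Nat.card H : ℂ)⁻¹ * ((Fintype.card G : ℂ) * f z) := by
  unfold indCF
  simp [hz]

lemma indAug_diff (H : Subgroup G) (z : G) (hz : ∀ x, x⁻¹ * z * x = z) (hzH : z ∈ H)
    (hz1 : z ≠ 1) :
    (Fintype.card G : ℂ)⁻¹ * (indAug H 1 - indAug H z) = 1 := by
  rw [indAug, indCF_central _ _ _ hz, indCF_central _ _ 1 (by simp)]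
  have hcard : (Nat.card H : ℂ) ≠ 0 := by exact_mod_cast Nat.card_pos.ne'
  have : (Fintype.card G : ℂ) ≠ 0 := by exact_mod_cast Fintype.card_ne_zero
  simp only [augChar, hzH, hz1, H.one_mem, if_true, if_false]
  field_simp
  ring

end CF

section Delta
variable {G : Type} [Group G] [Fintype G]

lemma fact4 : Nat.factorization 4 2 = 2 := by
  rw [show 4 = 2 ^ 2 by norm_num, Nat.Prime.factorization_pow Nat.prime_two]; simp

lemma fact2 : Nat.factorization 2 2 = 1 := by
  rw [Nat.Prime.factorization Nat.prime_two]; simp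

lemma delta_one (s : G) (hs : orderOf s = 4) :
    deltaMultSub 2 (zpowers s) 1 = 8 := by
  simp only [deltaMultSub, Subgroup.one_mem, if_true, Nat.card_zpowers, hs, fact4]
  norm_num

lemma delta_four (s t : G) (hs : orderOf s = 4) (ht : t ∈ zpowers s) (ht4 : orderOf t = 4) :
    deltaMultSub 2 (zpowers s) t = -2 := by
  have h1 : t ≠ 1 := by rintro rfl; simp at ht4
  simp only [deltaMultSub, ht, h1, if_true, if_false, Nat.card_zpowers, hs, ht4, fact4]
  norm_num

lemma delta_two (s t : G) (hs : orderOf s = 4) (ht : t ∈ zpowers s) (ht2 : orderOf t = 2) :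
    deltaMultSub 2 (zpowers s) t = -4 := by
  have h1 : t ≠ 1 := by rintro rfl; simp at ht2
  simp only [deltaMultSub, ht, h1, if_true, if_false, Nat.card_zpowers, hs, ht2, fact4, fact2]
  norm_num

open Classical in
lemma innerCF_delta (χ : G →* ℂˣ) (s : G) (hs : orderOf s = 4) (hχ : χ s = -1) :
    innerCF (fun g => (χ g : ℂ)) (indCF (zpowers s) (deltaMultSub 2 (zpowers s))) = 2 := by
  rw [innerCF_indCF, Nat.card_zpowers, hs]
  have h2 : orderOf (s ^ 2) = 2 := by rw [orderOf_pow, hs]; norm_num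
  have h3 : orderOf (s ^ 3) = 4 := by rw [orderOf_pow, hs]; norm_num
  have key : ∑ g : G, (starRingEnd ℂ) (χ g : ℂ) * deltaMultSub 2 (zpowers s) g
      = ∑ i ∈ Finset.range 4, (starRingEnd ℂ) (χ (s ^ i) : ℂ)
          * deltaMultSub 2 (zpowers s) (s ^ i) := by
    have hinj : Set.InjOn (fun i => s ^ i) (Finset.range 4 : Set ℕ) := by
      have := pow_injOn_Iio_orderOf (x := s)
      rw [hs] at this
      intro i hi j hj h
      exact this (by simpa using hi) (by simpa using hj) h
    rw [← Finset.sum_image (s := Finset.range 4) (g := fun i => s ^ i)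
      (f := fun g => (starRingEnd ℂ) (χ g : ℂ) * deltaMultSub 2 (zpowers s) g) hinj]
    symm
    apply Finset.sum_subset (Finset.subset_univ _)
    intro g _ hg
    have : g ∉ zpowers s := by
      intro h
      apply hg
      rw [mem_zpowers_iff_mem_range_orderOf, hs] at h
      exact h
    simp [deltaMultSub, this]
  rw [key]
  simp only [Finset.sum_range_succ, Finset.range_zero, Finset.sum_empty, pow_zero, pow_one]
  rw [delta_one s hs, delta_four s s hs (mem_zpowers s) hs,
    delta_two s _ hs (pow_mem (mem_zpowers s) 2) h2,
    delta_four s _ hs (pow_mem (mem_zpowers s) 3) h3]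
  simp [hχ]
  norm_num

lemma indCF_delta_diff (s : G) (hs : orderOf s = 4) (hz : ∀ x, x⁻¹ * s ^ 2 * x = s ^ 2) :
    (Fintype.card G : ℂ)⁻¹ * (indCF (zpowers s) (deltaMultSub 2 (zpowers s)) 1
      - indCF (zpowers s) (deltaMultSub 2 (zpowers s)) (s ^ 2)) = 3 := by
  have h2 : orderOf (s ^ 2) = 2 := by rw [orderOf_pow, hs]; norm_num
  rw [indCF_central _ _ _ hz, indCF_central _ _ 1 (by simp), delta_one s hs,
    delta_two s _ hs (pow_mem (mem_zpowers s) 2) h2, Nat.card_zpowers, hs]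
  have : (Fintype.card G : ℂ) ≠ 0 := by exact_mod_cast Fintype.card_ne_zero
  field_simp
  norm_num

end Delta

section Quat
open QuaternionGroup

variable {m : ℕ} [NeZero m]

lemma quat_z_central (x : QuaternionGroup m) :
    x⁻¹ * a (m : ZMod (2 * m)) * x = a (m : ZMod (2 * m)) := by
  rw [mul_assoc, inv_mul_eq_iff_eq_mul]
  have h : (m : ZMod (2 * m)) + m = 0 := by
    have := ZMod.natCast_self (2 * m)
    push_cast at this
    rw [← this]; ring
  rcases x with i | i
  · simp [add_comm]
  · simp only [a_mul_xa, xa_mul_a]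
    congr 1
    rw [sub_eq_add_neg, neg_eq_of_add_eq_zero_left h]

lemma quat_z_ne : (a (m : ZMod (2 * m)) : QuaternionGroup m) ≠ 1 := by
  rw [← xa_sq 0]
  intro h
  have := orderOf_dvd_of_pow_eq_one h
  rw [orderOf_xa] at this
  norm_num at this

lemma quat_z_mem (k : ℕ) (hm : m = 2 ^ k) (H : Subgroup (QuaternionGroup m)) (hH : H ≠ ⊥) :
    (a (m : ZMod (2 * m)) : QuaternionGroup m) ∈ H := by
  have hcard : Nat.card (QuaternionGroup m) = 2 ^ (k + 2) := by
    rw [Nat.card_eq_fintype_card, QuaternionGroup.card, hm]; ring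
  have hdvd := H.card_subgroup_dvd_card
  rw [hcard, Nat.dvd_prime_pow Nat.prime_two] at hdvd
  obtain ⟨j, -, hj⟩ := hdvd
  have h2 : 2 ∣ Nat.card H := by
    rw [hj]
    apply dvd_pow_self
    rintro rfl
    exact hH (Subgroup.card_eq_one.mp (by simpa using hj))
  haveI : Fact (Nat.Prime 2) := ⟨Nat.prime_two⟩
  obtain ⟨⟨x, hx⟩, hox⟩ := exists_prime_orderOf_dvd_card' 2 h2
  rw [Subgroup.orderOf_mk] at hox
  rcases x with i | i
  · have hx2 : (a i : QuaternionGroup m) ^ 2 = 1 := by rw [← hox]; exact pow_orderOf_eq_one _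
    have hne : (a i : QuaternionGroup m) ≠ 1 := by
      intro h; rw [h] at hox; simp at hox
    rw [sq, a_mul_a, one_def] at hx2
    have hi : i + i = 0 := QuaternionGroup.a.inj hx2
    have hi0 : i ≠ 0 := by rintro rfl; exact hne rfl
    have hmpos : 0 < m := NeZero.pos m
    have hlt := ZMod.val_lt i
    have hv : i.val ≠ 0 := by rwa [Ne, ZMod.val_eq_zero]
    have hd : 2 * m ∣ i.val + i.val := by
      rw [← ZMod.natCast_eq_zero_iff]
      push_cast
      rw [ZMod.natCast_zmod_val]; exact hi
    have : i.val = m := by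
      obtain ⟨c, hc⟩ := hd
      have hc1 : c = 1 := by
        have : c < 2 := by
          by_contra hcc
          have : 2 * m * 2 ≤ 2 * m * c := Nat.mul_le_mul_left _ (by omega)
          omega
        have : c ≠ 0 := by rintro rfl; omega
        omega
      subst hc1; omega
    have h3 : i = (m : ZMod (2 * m)) := by
      rw [← ZMod.natCast_zmod_val i]
      exact congrArg (Nat.cast : ℕ → ZMod (2 * m)) this
    rw [← h3]; exact hx
  · rw [orderOf_xa] at hox; norm_num at hox

lemma pm_of_order {G : Type} [Group G] (χ : G →* ℂˣ) (h : orderOf χ = 2) (g : G) :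
    χ g = 1 ∨ χ g = -1 := by
  have h1 : χ ^ 2 = 1 := by rw [← h]; exact pow_orderOf_eq_one χ
  have h2 : (χ g) ^ 2 = 1 := by
    have := DFunLike.congr_fun h1 g
    simpa using this
  have h3 : ((χ g : ℂˣ) : ℂ) ^ 2 = 1 := by
    rw [← Units.val_pow_eq_pow_val, h2, Units.val_one]
  rcases eq_or_eq_neg_of_sq_eq_sq ((χ g : ℂˣ) : ℂ) 1 (by rw [h3, one_pow]) with h | h
  · left; exact Units.ext h
  · right; exact Units.ext (by simpa using h)

lemma quat_hom_ext (χ ψ : QuaternionGroup m →* ℂˣ) (h1 : χ (a 1) = ψ (a 1))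
    (h2 : χ (xa 0) = ψ (xa 0)) : χ = ψ := by
  have ha : ∀ i, χ (a i) = ψ (a i) := by
    intro i
    rw [← ZMod.natCast_zmod_val i, ← a_one_pow, map_pow, map_pow, h1]
  ext x
  rcases x with i | i
  · rw [ha]
  · have : (xa i : QuaternionGroup m) = xa 0 * a i := by simp
    rw [this, map_mul, map_mul, ha, h2]

end Quat

open Classical in
lemma HurwitzTree.char_density {G : Type} [Group G] [Fintype G] (T : HurwitzTree G 2)
    (h0 : T.depth = 0) (χ : G →* ℂˣ) (hχ : ∀ g, χ g = 1 ∨ χ g = -1)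
    (b : T.V) (hb : T.IsLeaf b) (hQ : NTr χ (T.Gv b)) :
    innerCF (fun g => (χ g : ℂ)) (T.dv b)
      = (T.density (T.leaves.filter (fun b => NTr χ (T.Gv b))) b : ℂ) := by
  refine T.depth_eq_density (fun v => innerCF (fun g => (χ g : ℂ)) (T.av v))
    (fun v => innerCF (fun g => (χ g : ℂ)) (indAug (T.Gv v)))
    (fun v => innerCF (fun g => (χ g : ℂ)) (T.dv v)) (fun b => NTr χ (T.Gv b)) ?_ ?_ ?_ ?_ b hb hQ ?_
  · intro v hv hl
    rw [T.h3_inner v hv hl, innerCF_sum]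
  · intro b hb
    rw [T.h3_leaf b hb, innerCF_indAug χ hχ]
  · have : T.dv T.root = 0 := h0
    simp [this, innerCF]
  · intro v hv
    rw [T.h4 v hv, innerCF_h4]
  · intro v hv
    rw [innerCF_indAug χ hχ, if_pos]
    obtain ⟨g, hg⟩ := T.mono hv
    obtain ⟨x, hx, hx'⟩ := hQ
    refine ⟨_, hg x hx, ?_⟩
    simp [hx', mul_comm]

open Classical in
lemma HurwitzTree.artin_count {G : Type} [Group G] [Fintype G] (T : HurwitzTree G 2)
    (χ : G →* ℂˣ) (hχ : ∀ g, χ g = 1 ∨ χ g = -1) :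
    innerCF (fun g => (χ g : ℂ)) T.artin
      = ((T.leaves.filter (fun b => NTr χ (T.Gv b))).card : ℂ) := by
  have h := T.subtree_sum (fun v => innerCF (fun g => (χ g : ℂ)) (T.av v)) (by
    intro v hv hl
    rw [T.h3_inner v hv hl, innerCF_sum]) T.trunk T.trunk_ne
  have h2 : T.leaves.filter (fun b => T.le T.trunk b) = T.leaves := by
    apply Finset.filter_true_of_mem
    intro b hb
    have hbl : T.IsLeaf b := by simpa [MetricRootedTree.leaves] using hb
    exact T.trunk_le hbl.1
  rw [h2] at h
  rw [HurwitzTree.artin, h, Finset.card_filter]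
  push_cast
  apply Finset.sum_congr rfl
  intro b hb
  have hbl : T.IsLeaf b := by simpa [MetricRootedTree.leaves] using hb
  rw [T.h3_leaf b hbl, innerCF_indAug χ hχ]

open Classical in
lemma HurwitzTree.total_density {G : Type} [Group G] [Fintype G] (T : HurwitzTree G 2)
    (h0 : T.depth = 0) (z : G) (hz : ∀ x, x⁻¹ * z * x = z) (hz1 : z ≠ 1)
    (hzH : ∀ H : Subgroup G, H ≠ ⊥ → z ∈ H) (b : T.V) (hb : T.IsLeaf b) :
    (Fintype.card G : ℂ)⁻¹ * (T.dv b 1 - T.dv b z) = (T.density T.leaves b : ℂ) := by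
  have hf : T.leaves.filter T.IsLeaf = T.leaves := Finset.filter_true_of_mem (by simp [MetricRootedTree.leaves])
  rw [← hf]
  refine T.depth_eq_density (fun v => (Fintype.card G : ℂ)⁻¹ * (T.av v 1 - T.av v z))
    (fun v => (Fintype.card G : ℂ)⁻¹ * (indAug (T.Gv v) 1 - indAug (T.Gv v) z))
    (fun v => (Fintype.card G : ℂ)⁻¹ * (T.dv v 1 - T.dv v z)) T.IsLeaf ?_ ?_ ?_ ?_ b hb hb ?_
  · intro v hv hl
    rw [T.h3_inner v hv hl, ← Finset.sum_sub_distrib, Finset.mul_sum]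
  · intro b hb
    simp only [hb, if_true]
    rw [T.h3_leaf b hb, indAug_diff _ z hz (hzH _ (T.h2 b hb).1) hz1]
  · have : T.dv T.root = 0 := h0
    simp [this]
  · intro v hv
    rw [T.h4 v hv]
    ring
  · intro v hv
    rw [indAug_diff _ z hz _ hz1]
    apply hzH
    obtain ⟨g, hg⟩ := T.mono hv
    intro hbot
    have h1 := hg z (hzH _ (T.h2 b hb).1)
    rw [hbot, Subgroup.mem_bot] at h1
    apply hz1
    have := congrArg (fun y => g⁻¹ * y * g) h1
    simpa [mul_assoc] using this

open Classical in
lemma count_aux {α : Type*} (s : Finset α) (P0 P1 P2 : α → Prop)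
    (hrel : ∀ b ∈ s, (P2 b ↔ ¬ (P0 b ↔ P1 b))) (c0 : (s.filter P0).card = 2)
    (c12 : (s.filter P1).card = (s.filter P2).card) :
    (s.filter (fun b => P0 b ∧ P1 b)).card = 1 := by
  have key : (s.filter P0).card + (s.filter P1).card
      = (s.filter P2).card + 2 * (s.filter (fun b => P0 b ∧ P1 b)).card := by
    simp only [Finset.card_filter]
    rw [Finset.mul_sum, ← Finset.sum_add_distrib, ← Finset.sum_add_distrib]
    apply Finset.sum_congr rfl
    intro b hb
    have := hrel b hb
    by_cases h : P0 b <;> by_cases h' : P1 b <;> simp [this, h, h']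
  omega

open QuaternionGroup in
open Classical in
lemma main_aux (m k : ℕ) [NeZero m] (hm : m = 2 ^ k) (χ₀ χ₁ χ₂ : QuaternionGroup m →* ℂˣ)
    (hχ₀ : orderOf χ₀ = 2) (hχ₁ : orderOf χ₁ = 2) (hχ₂ : orderOf χ₂ = 2)
    (hk₀ : χ₀ (a 1) = 1) (hk₁ : χ₁ (xa 0) = 1) (hk₂ : χ₂ (xa 0 * a 1) = 1)
    (T : HurwitzTree (QuaternionGroup m) 2) (h0 : T.depth = 0) (l : ℕ)
    (hA0 : innerCF (fun g => (χ₀ g : ℂ)) T.artin = 2)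
    (hA1 : innerCF (fun g => (χ₁ g : ℂ)) T.artin = l)
    (hA2 : innerCF (fun g => (χ₂ g : ℂ)) T.artin = l) : False := by
  have p0 := pm_of_order χ₀ hχ₀
  have p1 := pm_of_order χ₁ hχ₁
  have p2 := pm_of_order χ₂ hχ₂
  have hne : (1 : ℂˣ) ≠ -1 := by
    intro h
    have := congrArg Units.val h
    norm_num at this
  have n0 : χ₀ ≠ 1 := by rintro rfl; simp at hχ₀
  have n1 : χ₁ ≠ 1 := by rintro rfl; simp at hχ₁
  have n2 : χ₂ ≠ 1 := by rintro rfl; simp at hχ₂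
  have v0 : χ₀ (xa 0) = -1 := (p0 _).resolve_left fun h =>
    n0 (quat_hom_ext _ _ (by simp [hk₀]) (by simp [h]))
  have v1 : χ₁ (a 1) = -1 := (p1 _).resolve_left fun h =>
    n1 (quat_hom_ext _ _ (by simp [h]) (by simp [hk₁]))
  rw [map_mul] at hk₂
  have v2 : χ₂ (a 1) = -1 := (p2 _).resolve_left fun h => by
    rw [h, mul_one] at hk₂
    exact n2 (quat_hom_ext _ _ (by simp [h]) (by simp [hk₂]))
  have v2' : χ₂ (xa 0) = -1 := by
    rw [v2] at hk₂
    rcases p2 (xa 0) with h | h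
    · rw [h] at hk₂; simp at hk₂
    · exact h
  have hprod : χ₂ = χ₀ * χ₁ := quat_hom_ext _ _ (by simp [hk₀, v1, v2]) (by simp [hk₁, v0, v2'])
  have ha : ∀ i, χ₀ (a i) = 1 := by
    intro i
    rw [← ZMod.natCast_zmod_val i, ← a_one_pow, map_pow, hk₀, one_pow]
  -- generators
  have hgen : ∀ b, T.IsLeaf b → ∃ g, T.Gv b = zpowers g := by
    intro b hb
    obtain ⟨g, hg⟩ := (Subgroup.isCyclic_iff_exists_zpowers_eq_top (T.Gv b)).mp (T.h2 b hb).2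
    exact ⟨g, hg.symm⟩
  have hiff : ∀ (χ : QuaternionGroup m →* ℂˣ), (∀ g, χ g = 1 ∨ χ g = -1) → ∀ s,
      NTr χ (zpowers s) ↔ χ s = -1 := by
    intro χ hχ s
    constructor
    · rintro ⟨g, ⟨j, rfl⟩, hg⟩
      refine (hχ s).resolve_left fun h => ?_
      simp [h] at hg
    · intro h; exact ⟨s, mem_zpowers s, h⟩
  rw [T.artin_count _ p0] at hA0
  rw [T.artin_count _ p1] at hA1
  rw [T.artin_count _ p2] at hA2
  set P0 : T.V → Prop := fun b => NTr χ₀ (T.Gv b) with hP0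
  set P1 : T.V → Prop := fun b => NTr χ₁ (T.Gv b) with hP1
  set P2 : T.V → Prop := fun b => NTr χ₂ (T.Gv b) with hP2
  have hrel : ∀ b ∈ T.leaves, (P2 b ↔ ¬ (P0 b ↔ P1 b)) := by
    intro b hb
    have hbl : T.IsLeaf b := by simpa [MetricRootedTree.leaves] using hb
    obtain ⟨s, hs⟩ := hgen b hbl
    simp only [hP0, hP1, hP2, hs, hiff _ p0, hiff _ p1, hiff _ p2]
    rw [hprod, MonoidHom.mul_apply]
    rcases p0 s with h | h <;> rcases p1 s with h' | h' <;> simp [h, h', hne]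
  have c0 : (T.leaves.filter P0).card = 2 := by exact_mod_cast hA0
  have c12 : (T.leaves.filter P1).card = (T.leaves.filter P2).card := by
    have := hA1.trans hA2.symm
    exact_mod_cast this
  have c01 : (T.leaves.filter (fun b => P0 b ∧ P1 b)).card = 1 := by
    exact count_aux T.leaves P0 P1 P2 hrel c0 c12
  obtain ⟨b, hb⟩ := Finset.card_eq_one.mp c01
  have hbm : b ∈ T.leaves.filter (fun b => P0 b ∧ P1 b) := by rw [hb]; simp
  obtain ⟨hbL, hb0, hb1⟩ := Finset.mem_filter.mp hbm
  have hbl : T.IsLeaf b := by simpa [MetricRootedTree.leaves] using hbL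
  obtain ⟨s, hs⟩ := hgen b hbl
  have hs0 : χ₀ s = -1 := (hiff _ p0 s).mp (hs ▸ hb0)
  have hs1 : χ₁ s = -1 := (hiff _ p1 s).mp (hs ▸ hb1)
  obtain ⟨j, rfl⟩ : ∃ j, s = xa j := by
    rcases s with i | i
    · exact absurd ((ha i).symm.trans hs0) hne
    · exact ⟨i, rfl⟩
  have ho : orderOf (xa j : QuaternionGroup m) = 4 := orderOf_xa j
  have hdv : T.dv b = indCF (zpowers (xa j)) (deltaMultSub 2 (zpowers (xa j))) := by
    apply T.h5 b hbl
    · rw [hs]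
    · apply IsPGroup.of_card (n := 2)
      rw [Nat.card_zpowers, ho]; norm_num
    · intro Q hQ _
      rwa [hs] at hQ
  have d0 := T.char_density h0 χ₀ p0 b hbl hb0
  have d1 := T.char_density h0 χ₁ p1 b hbl hb1
  have d := T.total_density h0 (a (m : ZMod (2 * m))) quat_z_central quat_z_ne
    (quat_z_mem k hm) b hbl
  rw [hdv, innerCF_delta _ _ ho hs0] at d0
  rw [hdv, innerCF_delta _ _ ho hs1] at d1
  have d3 := indCF_delta_diff (xa j : QuaternionGroup m) ho
    (by rw [xa_sq]; exact quat_z_central)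
  rw [xa_sq] at d3
  rw [hdv, d3] at d
  have e0 : T.density (T.leaves.filter P0) b = 2 := by exact_mod_cast d0.symm
  have e1 : T.density (T.leaves.filter P1) b = 2 := by exact_mod_cast d1.symm
  have e : T.density T.leaves b = 3 := by exact_mod_cast d.symm
  have hle : T.density (T.leaves.filter P0) b + T.density (T.leaves.filter P1) b
      ≤ T.density T.leaves b := by
    unfold MetricRootedTree.density
    rw [← Finset.sum_union]
    · apply Finset.sum_le_sum_of_subset_of_nonneg
      · intro x hx
        simp only [Finset.mem_union, Finset.mem_erase, Finset.mem_filter] at hx ⊢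
        tauto
      · intro x _ _
        exact T.idist_nonneg _ _
    · rw [Finset.disjoint_left]
      intro x hx hx'
      simp only [Finset.mem_erase, Finset.mem_filter] at hx hx'
      have : x ∈ T.leaves.filter (fun b => P0 b ∧ P1 b) := by
        simp only [Finset.mem_filter]; tauto
      rw [hb, Finset.mem_singleton] at this
      exact hx.1 this
  rw [e0, e1, e] at hle
  norm_num at hle

/-- There is no Hurwitz tree `T` of type `(G,2)` with `G = Q_{2^{n+1}}` (`n ≥ 2`),
`δ_T = 0`, and Artin character `a_T` satisfying `⟨a_T, χ₀⟩ = 2` and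
`⟨a_T, χ₁⟩ = ⟨a_T, χ₂⟩ ≥ 2`, where `χᵢ` is the order-`2` character of `G` whose kernel
contains `Hᵢ` (`H₀ = ⟨τ⟩`, `H₁ = ⟨σ⟩`, `H₂ = ⟨στ⟩`). -/
theorem stmt18 (n : ℕ) (hn : 2 ≤ n)
    (χ₀ χ₁ χ₂ : QuaternionGroup (2 ^ (n - 1)) →* ℂˣ)
    (hχ₀ : orderOf χ₀ = 2) (hχ₁ : orderOf χ₁ = 2) (hχ₂ : orderOf χ₂ = 2)
    (hk₀ : zpowers (QuaternionGroup.a 1) ≤ χ₀.ker)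
    (hk₁ : zpowers (QuaternionGroup.xa 0) ≤ χ₁.ker)
    (hk₂ : zpowers (QuaternionGroup.xa 0 * QuaternionGroup.a 1) ≤ χ₂.ker) :
    ¬ ∃ (T : HurwitzTree (QuaternionGroup (2 ^ (n - 1))) 2) (k : ℕ),
        T.depth = 0 ∧
        innerCF (fun g => (χ₀ g : ℂ)) T.artin = 2 ∧
        2 ≤ k ∧
        innerCF (fun g => (χ₁ g : ℂ)) T.artin = k ∧
        innerCF (fun g => (χ₂ g : ℂ)) T.artin = k := by
  rintro ⟨T, l, h0, hA0, -, hA1, hA2⟩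
  exact main_aux (2 ^ (n - 1)) (n - 1) rfl χ₀ χ₁ χ₂ hχ₀ hχ₁ hχ₂
    (hk₀ (mem_zpowers _)) (hk₁ (mem_zpowers _)) (hk₂ (mem_zpowers _)) T h0 l hA0 hA1 hA2
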